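/- arXiv:2104.06260 — 9 statements merged into one kernel-verified Lean document; each statement's English description precedes it below -/
import Mathlib

section
/- Let 0 < λ < 1 and α = 1 − λ. For every integer i ≥ 1, define Z_i = [(i+α)^(2−λ) − (i−1+α)^(2−λ) − (2−λ)·(i−1+α)^(1−λ)] / ((2−λ)·((i+α)^(1−λ) − (i−1+α)^(1−λ))). Then 1/2 < Z_i < 1/(2−λ). -/
/-- `x ↦ log (1 + x) - log (1 - x)` is strictly star-shaped on `(0, 1)`. -/
theorem log_one_add_mul_sub_log_one_sub_mul_lt {s x : ℝ} (hs0 : 0 < s) (hs1 : s < 1)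
    (hx0 : 0 < x) (hx1 : x < 1) :
    Real.log (1 + s * x) - Real.log (1 - s * x) <
      s * (Real.log (1 + x) - Real.log (1 - x)) := by
  have hsx : |s * x| < 1 := by
    rw [abs_of_pos (mul_pos hs0 hx0)]
    nlinarith
  have h1 := Real.hasSum_log_sub_log_of_abs_lt_one hsx
  have h2 := (Real.hasSum_log_sub_log_of_abs_lt_one
    (show |x| < 1 by rwa [abs_of_pos hx0])).mul_left s
  refine hasSum_lt (i := 1) (fun k => ?_) ?_ h1 h2
  · have hk : s ^ (2 * k + 1) ≤ s := pow_le_of_le_one hs0.le hs1.le (by omega)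
    calc (2 : ℝ) * (1 / (2 * k + 1)) * (s * x) ^ (2 * k + 1)
        = s ^ (2 * k + 1) * (2 * (1 / (2 * k + 1)) * x ^ (2 * k + 1)) := by
          rw [mul_pow]; ring
      _ ≤ s * (2 * (1 / (2 * k + 1)) * x ^ (2 * k + 1)) := by gcongr
  · have hk : s ^ 3 < s := pow_lt_self_of_lt_one₀ hs0 hs1 (by norm_num)
    have hx3 : 0 < x ^ 3 := by positivity
    norm_num [mul_pow]
    nlinarith

/-- The trapezoidal rule underestimates the integral of `x ^ s` over `[b, b + 1]`. -/
theorem rpow_mul_lt_add_one_rpow_mul {s b : ℝ} (hs0 : 0 < s) (hs1 : s < 1) (hb : 0 < b) :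
    b ^ s * (2 * b + 1 + s) < (b + 1) ^ s * (2 * b + 1 - s) := by
  have hm : 0 < 2 * b + 1 := by positivity
  have hms : 0 < 2 * b + 1 - s := by linarith
  have hms' : 0 < 2 * b + 1 + s := by linarith
  have hb1 : 0 < b + 1 := by linarith
  have h := log_one_add_mul_sub_log_one_sub_mul_lt hs0 hs1 (x := (2 * b + 1)⁻¹)
    (inv_pos.2 hm) (inv_lt_one_of_one_lt₀ (by linarith))
  have e1 : 1 + s * (2 * b + 1)⁻¹ = (2 * b + 1 + s) / (2 * b + 1) := by field_simp
  have e2 : 1 - s * (2 * b + 1)⁻¹ = (2 * b + 1 - s) / (2 * b + 1) := by field_simp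
  have e3 : 1 + (2 * b + 1)⁻¹ = 2 * (b + 1) / (2 * b + 1) := by field_simp; ring
  have e4 : 1 - (2 * b + 1)⁻¹ = 2 * b / (2 * b + 1) := by field_simp; ring
  rw [e1, e2, e3, e4, Real.log_div hms'.ne' hm.ne', Real.log_div hms.ne' hm.ne',
    Real.log_div (by positivity) hm.ne', Real.log_div (by positivity) hm.ne',
    Real.log_mul two_ne_zero hb1.ne', Real.log_mul two_ne_zero hb.ne'] at h
  rw [← Real.log_lt_log_iff (by positivity) (by positivity),
    Real.log_mul (by positivity) hms'.ne', Real.log_mul (by positivity) hms.ne',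
    Real.log_rpow hb, Real.log_rpow hb1]
  linarith

/-- Bernoulli's inequality for exponents in `(0, 1)`, with denominators cleared. -/
theorem mul_add_one_rpow_lt {s b : ℝ} (hs0 : 0 < s) (hs1 : s < 1) (hb : 0 < b) :
    b * (b + 1) ^ s < (b + s) * b ^ s := by
  have h := rpow_one_add_lt_one_add_mul_self (s := b⁻¹) (p := s)
    (by linarith [inv_pos.2 hb]) (inv_ne_zero hb.ne') hs0 hs1
  have e : b + 1 = b * (1 + b⁻¹) := by field_simp
  rw [e, Real.mul_rpow hb.le (by positivity)]
  calc b * (b ^ s * (1 + b⁻¹) ^ s) < b * (b ^ s * (1 + s * b⁻¹)) := by gcongr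
    _ = (b + s) * b ^ s := by field_simp


/-- Lemma 3.4: bounds on the quotient Z_i arising in the Caputo-derivative weights. -/
theorem stmt_0 (lam α : ℝ) (hlam0 : 0 < lam) (hlam1 : lam < 1) (hα : α = 1 - lam)
    (i : ℕ) (hi : 1 ≤ i) :
    1 / 2 <
      (((i : ℝ) + α) ^ (2 - lam) - ((i : ℝ) - 1 + α) ^ (2 - lam)
          - (2 - lam) * ((i : ℝ) - 1 + α) ^ (1 - lam)) /
        ((2 - lam) * (((i : ℝ) + α) ^ (1 - lam) - ((i : ℝ) - 1 + α) ^ (1 - lam))) ∧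
    (((i : ℝ) + α) ^ (2 - lam) - ((i : ℝ) - 1 + α) ^ (2 - lam)
        - (2 - lam) * ((i : ℝ) - 1 + α) ^ (1 - lam)) /
      ((2 - lam) * (((i : ℝ) + α) ^ (1 - lam) - ((i : ℝ) - 1 + α) ^ (1 - lam)))
      < 1 / (2 - lam) := by
  obtain ⟨b, hb⟩ : ∃ b : ℝ, b = (i : ℝ) - 1 + α := ⟨_, rfl⟩
  have hi' : (1 : ℝ) ≤ i := by exact_mod_cast hi
  have hb0 : 0 < b := by linarith
  have ha : (i : ℝ) + α = b + 1 := by linarith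
  have hlam : lam = 1 - α := by linarith
  have hs0 : 0 < α := by linarith
  have hs1 : α < 1 := by linarith
  have hp : 2 - (1 - α) = 1 + α := by ring
  rw [← hb, ha, hlam, hp, sub_sub_cancel, Real.rpow_one_add' (by linarith) (by linarith),
    Real.rpow_one_add' hb0.le (by linarith)]
  have hlow := rpow_mul_lt_add_one_rpow_mul hs0 hs1 hb0
  have hup := mul_add_one_rpow_lt hs0 hs1 hb0
  have hD : 0 < (b + 1) ^ α - b ^ α :=
    sub_pos.2 (Real.rpow_lt_rpow hb0.le (by linarith) hs0)
  constructor
  · rw [div_lt_div_iff₀ two_pos (by positivity)]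
    linarith
  · rw [← div_div, div_right_comm, div_lt_div_iff_of_pos_right (by linarith), div_lt_one hD]
    linarith
end

section
/- Let 0 < λ < 1 and α = 1 − λ. For every integer l ≥ 1, (1/(2−λ))·((l+α)^(2−λ) − (l−1+α)^(2−λ)) − (1/2)·((l+α)^(1−λ) + (l−1+α)^(1−λ)) > 0. -/
/-- A tangent line to `x ↦ x ^ p`, `0 < p < 1`, lies strictly above the graph. -/
theorem rpow_lt_rpow_add_tangent {p a t : ℝ} (hp0 : 0 < p) (hp1 : p < 1) (ha : 0 ≤ a)
    (hat : a < t) : a ^ p < t ^ p + p * t ^ (p - 1) * (a - t) := by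
  have ht : 0 < t := ha.trans_lt hat
  have hdiv : 0 ≤ a / t := by positivity
  have hdiv1 : a / t < 1 := (div_lt_one ht).2 hat
  have hB := rpow_one_add_lt_one_add_mul_self (s := a / t - 1) (by linarith) (by linarith) hp0 hp1
  rw [add_sub_cancel, Real.div_rpow ha ht.le, div_lt_iff₀ (by positivity)] at hB
  rw [Real.rpow_sub_one ht.ne']
  refine hB.trans_eq ?_
  field_simp

/-- The trapezoidal rule strictly underestimates the integral of `x ↦ x ^ p`, `0 < p < 1`. -/
theorem trapezoid_rpow_lt {p a b : ℝ} (hp0 : 0 < p) (hp1 : p < 1) (ha : 0 < a) (hab : a < b) :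
    (b - a) / 2 * (a ^ p + b ^ p) < (b ^ (p + 1) - a ^ (p + 1)) / (p + 1) := by
  have hderiv : ∀ t, 0 < t → HasDerivAt
      (fun t : ℝ ↦ (t ^ (p + 1) - a ^ (p + 1)) / (p + 1) - (t - a) / 2 * (a ^ p + t ^ p))
      ((t ^ p - a ^ p - (t - a) * (p * t ^ (p - 1))) / 2) t := by
    intro t ht
    have h1 := Real.hasDerivAt_rpow_const (x := t) (p := p + 1) (Or.inl ht.ne')
    have h2 := Real.hasDerivAt_rpow_const (x := t) (p := p) (Or.inl ht.ne')
    have h3 := ((hasDerivAt_id' t).sub_const a).div_const 2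
    refine (((h1.sub_const (a ^ (p + 1))).div_const (p + 1)).sub
      (h3.mul (h2.const_add (a ^ p)))).congr_deriv ?_
    rw [add_sub_cancel_right]
    field_simp
    ring
  have hmono := strictMonoOn_of_deriv_pos (convex_Icc a b)
    (fun t ht ↦ (hderiv t (ha.trans_le ht.1)).continuousAt.continuousWithinAt) (fun t ht ↦ by
      rw [interior_Icc] at ht
      rw [(hderiv t (ha.trans ht.1)).deriv]
      linarith [rpow_lt_rpow_add_tangent hp0 hp1 ha.le ht.1])
  have h := hmono (Set.left_mem_Icc.2 hab.le) (Set.right_mem_Icc.2 hab.le) hab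
  simp only [sub_self, zero_div, zero_mul] at h
  linarith

/-- Lemma 3.5: positivity of (1/(2−λ))((l+α)^{2−λ} − (l−1+α)^{2−λ}) − (1/2)((l+α)^{1−λ} + (l−1+α)^{1−λ}). -/
theorem stmt_1 (lam α : ℝ) (hlam0 : 0 < lam) (hlam1 : lam < 1) (hα : α = 1 - lam)
    (l : ℕ) (hl : 1 ≤ l) :
    0 < (1 / (2 - lam)) * (((l : ℝ) + α) ^ (2 - lam) - ((l : ℝ) - 1 + α) ^ (2 - lam))
        - (1 / 2) * (((l : ℝ) + α) ^ (1 - lam) + ((l : ℝ) - 1 + α) ^ (1 - lam)) := by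
  have hl' : (1 : ℝ) ≤ l := by exact_mod_cast hl
  have h := trapezoid_rpow_lt (p := 1 - lam) (a := (l : ℝ) - 1 + α) (b := (l : ℝ) + α)
    (by linarith) (by linarith) (by linarith) (by linarith)
  rw [show 1 - lam + 1 = 2 - lam by ring,
    show (l : ℝ) + α - ((l : ℝ) - 1 + α) = 1 by ring,
    div_eq_inv_mul _ (2 - lam), ← one_div (2 - lam)] at h
  linarith
end

section
/- Let 0 < λ < 1 and α = 1 − λ. Then for all integers i ≥ 0 and 0 ≤ l ≤ i, the weight f(i+1,l) is strictly positive, i.e. (2/(2−λ))·((i+1+α−l)^(2−λ) − (i+α−l)^(2−λ)) − (1/2)·((i+1+α−l)^(1−λ) + 3·(i+α−l)^(1−λ)) > 0. -/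
/-- The trapezoidal rule underestimates the integral of the concave function `t ↦ t ^ p`. -/
theorem rpow_trapezoid_le_integral {p x : ℝ} (hp0 : 0 ≤ p) (hp1 : p ≤ 1) (hx : 0 ≤ x) :
    (x ^ p + (x + 1) ^ p) / 2 ≤ ((x + 1) ^ (p + 1) - x ^ (p + 1)) / (p + 1) := by
  rw [← integral_rpow (Or.inl (by linarith))]
  have chord : ∀ t ∈ Set.Icc x (x + 1), x ^ p + (t - x) * ((x + 1) ^ p - x ^ p) ≤ t ^ p := by
    intro t ht
    have h := (Real.concaveOn_rpow hp0 hp1).2 (Set.mem_Ici.2 hx)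
      (Set.mem_Ici.2 (by linarith : (0 : ℝ) ≤ x + 1)) (by linarith [ht.2] : 0 ≤ 1 - (t - x))
      (by linarith [ht.1] : 0 ≤ t - x) (by ring)
    simp only [smul_eq_mul] at h
    rw [show (1 - (t - x)) * x + (t - x) * (x + 1) = t by ring] at h
    linarith
  have h := intervalIntegral.integral_mono_on (μ := MeasureTheory.volume) (by linarith)
    (Continuous.intervalIntegrable (by fun_prop) x (x + 1))
    (intervalIntegral.intervalIntegrable_rpow' (by linarith)) chord
  refine le_trans (le_of_eq ?_) h
  rw [intervalIntegral.integral_add (by simp)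
    (Continuous.intervalIntegrable (by fun_prop) _ _), intervalIntegral.integral_mul_const,
    intervalIntegral.integral_sub (by simp) (by simp)]
  simp only [intervalIntegral.integral_const, integral_id, smul_eq_mul]
  ring


/-- Relation (97), Lemma 3.6: positivity of the weight f(i+1,l). -/
theorem stmt_2 (lam α : ℝ) (hlam0 : 0 < lam) (hlam1 : lam < 1) (hα : α = 1 - lam)
    (i l : ℕ) (hl : l ≤ i) :
    0 < (2 / (2 - lam)) * (((i : ℝ) + 1 + α - l) ^ (2 - lam) - ((i : ℝ) + α - l) ^ (2 - lam))
        - (1 / 2) * (((i : ℝ) + 1 + α - l) ^ (1 - lam) + 3 * ((i : ℝ) + α - l) ^ (1 - lam)) := by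
  have hli : (l : ℝ) ≤ i := by exact_mod_cast hl
  have hx : 0 ≤ (i : ℝ) + α - l := by linarith
  rw [show (i : ℝ) + 1 + α - l = (i + α - l) + 1 by ring, show 2 - lam = 1 - lam + 1 by ring,
    div_mul_eq_mul_div, mul_div_assoc]
  have trapezoid := rpow_trapezoid_le_integral (by linarith : 0 ≤ 1 - lam) (by linarith) hx
  have increasing := Real.rpow_lt_rpow hx (lt_add_one _) (by linarith : 0 < 1 - lam)
  linarith
end

section
/- Let 0 < λ < 2/3 and α = 1 − λ. Then for all integers i ≥ 0 and 0 ≤ l ≤ i, one has d(i+1,l) − f(i+1,l) > 0, i.e. (3/2)·((i+1+α−l)^(1−λ) − (i+α−l)^(1−λ)) − (2/(2−λ))·((i+1+α−l)^(2−λ) − (i+α−l)^(2−λ)) + (1/2)·((i+1+α−l)^(1−λ) + 3·(i+α−l)^(1−λ)) − ((i+1+α−l)^(1−λ) − (i+α−l)^(1−λ)) + (d(i+1,l) − d(i+1,l)) > 0, equivalently d(i+1,l) > f(i+1,l). -/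
/-- The derivative of `quadratureGap`. -/
noncomputable def quadratureGapDeriv (a t : ℝ) : ℝ := a * t ^ (a - 1) + (3 - a) * t ^ a - 3

/-- Four times the gap between `3 / 4 * f 1 + 1 / 4 * f t` and the mean of `f` over `[t, 1]`
for `f s = s ^ a`, multiplied by the length `1 - t` of the interval. -/
noncomputable def quadratureGap (a t : ℝ) : ℝ :=
  3 - 4 / (a + 1) - 3 * t + t ^ a + (3 - a) / (a + 1) * t ^ (a + 1)

lemma hasDerivAt_quadratureGap {a t : ℝ} (ha : 0 < a) (ht : 0 < t) :
    HasDerivAt (quadratureGap a) (quadratureGapDeriv a t) t := by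
  have h1 := Real.hasDerivAt_rpow_const (x := t) (p := a) (Or.inl ht.ne')
  have h2 := Real.hasDerivAt_rpow_const (x := t) (p := a + 1) (Or.inl ht.ne')
  have h := ((((hasDerivAt_id t).const_mul 3).const_sub (3 - 4 / (a + 1))).add h1).add
    (h2.const_mul ((3 - a) / (a + 1)))
  refine h.congr_deriv ?_
  unfold quadratureGapDeriv
  rw [add_sub_cancel_right]
  field_simp
  ring

lemma continuous_quadratureGap {a : ℝ} (ha : 0 < a) : Continuous (quadratureGap a) := by
  unfold quadratureGap
  have h1 := Real.continuous_rpow_const ha.le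
  have h2 := Real.continuous_rpow_const (q := a + 1) (by linarith)
  fun_prop

lemma hasDerivAt_quadratureGapDeriv {a t : ℝ} (ht : 0 < t) :
    HasDerivAt (quadratureGapDeriv a) (a * t ^ (a - 2) * ((3 - a) * t - (1 - a))) t := by
  have h1 := Real.hasDerivAt_rpow_const (x := t) (p := a - 1) (Or.inl ht.ne')
  have h2 := Real.hasDerivAt_rpow_const (x := t) (p := a) (Or.inl ht.ne')
  refine (((h1.const_mul a).add (h2.const_mul (3 - a))).sub_const 3).congr_deriv ?_
  have e1 : a - 1 - 1 = a - 2 := by ring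
  have e2 : t ^ (a - 1) = t ^ (a - 2) * t := by
    rw [← Real.rpow_add_one ht.ne']
    ring_nf
  rw [e1, e2]
  ring

lemma strictAntiOn_quadratureGapDeriv {a : ℝ} (ha : 0 < a) (ha1 : a < 1) :
    StrictAntiOn (quadratureGapDeriv a) (Set.Ioc 0 ((1 - a) / (3 - a))) := by
  refine strictAntiOn_of_deriv_neg (convex_Ioc _ _) (fun t ht =>
    (hasDerivAt_quadratureGapDeriv ht.1).continuousAt.continuousWithinAt) fun t ht => ?_
  rw [interior_Ioc] at ht
  rw [(hasDerivAt_quadratureGapDeriv ht.1).deriv]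
  have h := (lt_div_iff₀ (by linarith)).1 ht.2
  have := Real.rpow_pos_of_pos ht.1 (a - 2)
  exact mul_neg_of_pos_of_neg (by positivity) (by linarith)

lemma quadratureGapDeriv_neg {a t : ℝ} (ha : 0 < a) (ha1 : a < 1)
    (ht : (1 - a) / (3 - a) ≤ t) (ht1 : t < 1) : quadratureGapDeriv a t < 0 := by
  have hpos : 0 < (1 - a) / (3 - a) := div_pos (by linarith) (by linarith)
  have hmono : StrictMonoOn (quadratureGapDeriv a) (Set.Icc ((1 - a) / (3 - a)) 1) := by
    refine strictMonoOn_of_deriv_pos (convex_Icc _ _) (fun s hs =>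
      (hasDerivAt_quadratureGapDeriv (hpos.trans_le hs.1)).continuousAt.continuousWithinAt)
      fun s hs => ?_
    rw [interior_Icc] at hs
    have hs0 := hpos.trans hs.1
    rw [(hasDerivAt_quadratureGapDeriv hs0).deriv]
    have h := (div_lt_iff₀ (by linarith)).1 hs.1
    have := Real.rpow_pos_of_pos hs0 (a - 2)
    exact mul_pos (by positivity) (by linarith)
  have h := hmono ⟨ht, ht1.le⟩ ⟨ht.trans ht1.le, le_rfl⟩ ht1
  have h1 : quadratureGapDeriv a 1 = 0 := by simp [quadratureGapDeriv]
  rwa [h1] at h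

lemma quadratureGap_pos {a t : ℝ} (ha : 1 / 3 < a) (ha1 : a < 1) (ht : 0 < t) (ht1 : t < 1) :
    0 < quadratureGap a t := by
  have ha0 : 0 < a := by linarith
  have hanti := strictAntiOn_quadratureGapDeriv ha0 ha1
  rcases lt_or_ge (quadratureGapDeriv a t) 0 with hneg | hnonneg
  · have hG : StrictAntiOn (quadratureGap a) (Set.Icc t 1) := by
      refine strictAntiOn_of_deriv_neg (convex_Icc _ _)
        (continuous_quadratureGap ha0).continuousOn fun s hs => ?_
      rw [interior_Icc] at hs
      rw [(hasDerivAt_quadratureGap ha0 (ht.trans hs.1)).deriv]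
      rcases le_total ((1 - a) / (3 - a)) s with h | h
      · exact quadratureGapDeriv_neg ha0 ha1 h hs.2
      · exact (hanti ⟨ht, hs.1.le.trans h⟩ ⟨ht.trans hs.1, h⟩ hs.1).trans hneg
    have h := hG ⟨le_rfl, ht1.le⟩ ⟨ht1.le, le_rfl⟩ ht1
    have h1 : quadratureGap a 1 = 0 := by
      simp only [quadratureGap, Real.one_rpow]
      field_simp
      ring
    rwa [h1] at h
  · have htle : t ≤ (1 - a) / (3 - a) := by
      by_contra! h
      exact hnonneg.not_gt (quadratureGapDeriv_neg ha0 ha1 h.le ht1)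
    have hG : StrictMonoOn (quadratureGap a) (Set.Icc 0 t) := by
      refine strictMonoOn_of_deriv_pos (convex_Icc _ _)
        (continuous_quadratureGap ha0).continuousOn fun s hs => ?_
      rw [interior_Icc] at hs
      rw [(hasDerivAt_quadratureGap ha0 hs.1).deriv]
      exact hnonneg.trans_lt (hanti ⟨hs.1, hs.2.le.trans htle⟩ ⟨ht, htle⟩ hs.2)
    refine lt_trans ?_ (hG ⟨le_rfl, ht.le⟩ ⟨ht.le, le_rfl⟩ ht)
    have h4 : 4 / (a + 1) < 3 := by
      rw [div_lt_iff₀ (by linarith)]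
      linarith
    rw [quadratureGap, Real.zero_rpow ha0.ne', Real.zero_rpow (by linarith)]
    linarith

lemma rpow_integral_lt_quadrature {a x : ℝ} (ha : 1 / 3 < a) (ha1 : a < 1) (hx : 0 < x) :
    2 / (a + 1) * ((x + 1) ^ (a + 1) - x ^ (a + 1))
      < 3 / 2 * (x + 1) ^ a + 1 / 2 * x ^ a := by
  have hy : 0 < x + 1 := by linarith
  have hY := Real.rpow_pos_of_pos hy a
  have ht : 0 < x / (x + 1) := by positivity
  have h := quadratureGap_pos ha ha1 ht ((div_lt_one hy).2 (by linarith))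
  rw [quadratureGap, Real.rpow_add_one ht.ne', Real.div_rpow hx.le hy.le] at h
  rw [Real.rpow_add_one hy.ne', Real.rpow_add_one hx.ne', ← sub_pos]
  have h' := mul_pos (half_pos (mul_pos hy hY)) h
  refine h'.trans_eq ?_
  have : a + 1 ≠ 0 := by linarith
  field_simp
  ring

/-- Relation (97), Lemma 3.6: d(i+1,l) − f(i+1,l) > 0 for 0 < λ < 2/3. -/
theorem stmt_3 (lam α : ℝ) (hlam0 : 0 < lam) (hlam1 : lam < 2 / 3) (hα : α = 1 - lam)
    (i l : ℕ) (hl : l ≤ i) :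
    (2 / (2 - lam)) * (((i : ℝ) + 1 + α - l) ^ (2 - lam) - ((i : ℝ) + α - l) ^ (2 - lam))
        - (1 / 2) * (((i : ℝ) + 1 + α - l) ^ (1 - lam) + 3 * ((i : ℝ) + α - l) ^ (1 - lam))
      < ((i : ℝ) + 1 + α - l) ^ (1 - lam) - ((i : ℝ) + α - l) ^ (1 - lam) := by
  have hl' : (l : ℝ) ≤ i := by exact_mod_cast hl
  have h := rpow_integral_lt_quadrature (a := 1 - lam) (x := (i : ℝ) + α - l)
    (by linarith) (by linarith) (by linarith)
  have e1 : (i : ℝ) + α - l + 1 = i + 1 + α - l := by ring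
  have e2 : 1 - lam + 1 = 2 - lam := by ring
  rw [e1, e2] at h
  linarith
end

section
/- Let 0 < λ < 2/3 and α = 1 − λ. Then for all integers i ≥ 0 and 0 ≤ j ≤ i, one has f(i+1,j−1) + f(i+1,j) − d(i+1,j) < 0, where f(i+1,j−1) is defined by the same formula with l = j−1 (so its bases are i+2+α−j and i+1+α−j). -/
/-- The binomial series on the open unit interval. -/
lemma hasSum_choose_mul_pow (a : ℝ) {x : ℝ} (hx : |x| < 1) :
    HasSum (fun n : ℕ ↦ Ring.choose a n * x ^ n) ((1 + x) ^ a) := by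
  have hmem : x ∈ Metric.eball (0 : ℝ) 1 := by
    rw [Metric.mem_eball, edist_dist, Real.dist_eq, sub_zero, ← ENNReal.ofReal_one]
    exact (ENNReal.ofReal_lt_ofReal_iff one_pos).2 hx
  have h := (Real.one_add_rpow_hasFPowerSeriesOnBall_zero (a := a)).hasSum hmem
  simpa only [binomialSeries_apply, List.ofFn_const, List.prod_replicate, smul_eq_mul, zero_add]
    using h

lemma hasSum_even_binomial (a : ℝ) {x : ℝ} (hx : |x| < 1) :
    HasSum (fun k : ℕ ↦ 2 * Ring.choose a (2 * k) * x ^ (2 * k))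
      ((1 + x) ^ a + (1 - x) ^ a) := by
  have h := (hasSum_choose_mul_pow a hx).add
    (hasSum_choose_mul_pow a (x := -x) (by rwa [abs_neg]))
  rw [← sub_eq_add_neg,
    ← (mul_right_injective₀ (two_ne_zero' ℕ)).hasSum_iff (fun n hn ↦ ?_)] at h
  · refine h.congr_fun ?_
    intro k
    simp only [Function.comp_apply, (even_two_mul k).neg_pow]
    ring
  · have hodd : Odd n := by
      rw [← Nat.not_even_iff_odd, even_iff_exists_two_mul]
      rintro ⟨k, rfl⟩
      exact hn ⟨k, rfl⟩
    rw [hodd.neg_pow]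
    ring

lemma hasSum_odd_binomial (a : ℝ) {x : ℝ} (hx : |x| < 1) :
    HasSum (fun k : ℕ ↦ 2 * Ring.choose a (2 * k + 1) * x ^ (2 * k + 1))
      ((1 + x) ^ a - (1 - x) ^ a) := by
  have h := (hasSum_choose_mul_pow a hx).sub
    (hasSum_choose_mul_pow a (x := -x) (by rwa [abs_neg]))
  have hinj : Function.Injective fun k : ℕ ↦ 2 * k + 1 := fun k l hkl ↦ by
    simpa using hkl
  rw [← sub_eq_add_neg, ← hinj.hasSum_iff (fun n hn ↦ ?_)] at h
  · refine h.congr_fun ?_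
    intro k
    simp only [Function.comp_apply, (odd_two_mul_add_one k).neg_pow]
    ring
  · have heven : Even n := by
      rw [← Nat.not_odd_iff_even]
      rintro ⟨k, rfl⟩
      exact hn ⟨k, rfl⟩
    rw [heven.neg_pow]
    ring

lemma succ_mul_choose_succ (a : ℝ) (n : ℕ) :
    ((n : ℝ) + 1) * Ring.choose a (n + 1) = Ring.choose a n * (a - n) := by
  simpa [Ring.choose_one_right] using Ring.choose_smul_choose a (Nat.le_succ n)

lemma succ_mul_choose_add_one_succ (a : ℝ) (n : ℕ) :
    ((n : ℝ) + 1) * Ring.choose (a + 1) (n + 1) = (a + 1) * Ring.choose a n := by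
  simpa [Ring.choose_one_right] using Ring.choose_add_smul_choose a n 1

lemma choose_add_two (a : ℝ) (n : ℕ) :
    Ring.choose a (n + 2) = Ring.choose a n * ((a - n) * (a - n - 1) / ((n + 1) * (n + 2))) := by
  have h₁ := succ_mul_choose_succ a n
  have h₂ := succ_mul_choose_succ a (n + 1)
  push_cast at h₂
  field_simp
  linear_combination ((n : ℝ) + 1) * h₂ + (a - n - 1) * h₁

/-- A sequence dominated by a geometric progression has sum at most that of the progression. -/
lemma hasSum_le_of_ratio_le {T : ℕ → ℝ} {s r : ℝ} (hT : HasSum T s) (hr0 : 0 ≤ r) (hr1 : r < 1)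
    (hratio : ∀ k, T (k + 1) ≤ r * T k) : s ≤ T 0 * (1 - r)⁻¹ := by
  refine hasSum_le (fun k ↦ ?_) hT ((hasSum_geometric_of_lt_one hr0 hr1).mul_left (T 0))
  induction k with
  | zero => simp
  | succ k ih =>
    calc T (k + 1) ≤ r * T k := hratio k
      _ ≤ r * (T 0 * r ^ k) := by gcongr
      _ = T 0 * r ^ (k + 1) := by ring

lemma choose_two_mul_add_four_nonpos {p : ℝ} (hp0 : 0 < p) (hp1 : p < 1) (k : ℕ) :
    Ring.choose p (2 * k + 4) ≤ 0 := by
  induction k with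
  | zero =>
    rw [choose_add_two, choose_add_two p 0, Ring.choose_zero_right]
    norm_num
    have : 0 < p * (1 - p) * (2 - p) * (3 - p) := by
      have := sub_pos.2 hp1
      have : 0 < 2 - p := by linarith
      have : 0 < 3 - p := by linarith
      positivity
    nlinarith
  | succ k ih =>
    rw [show 2 * (k + 1) + 4 = (2 * k + 4) + 2 by ring, choose_add_two]
    refine mul_nonpos_of_nonpos_of_nonneg ih (div_nonneg ?_ (by positivity))
    push_cast
    have hk : (0 : ℝ) ≤ k := k.cast_nonneg
    exact mul_nonneg_of_nonpos_of_nonpos (by linarith) (by linarith)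

/-- The integral of the concave power `s ↦ s ^ p` over `[1 - t, 1 + t]` compared with the quadrature
rule of weights `1 / 8`, `3 / 4`, `1 / 8`. -/
lemma rpow_quadrature_lt {p t : ℝ} (hp0 : 0 < p) (hp1 : p < 1) (ht0 : 0 < t) (ht1 : t ≤ 3 / 4) :
    2 / (p + 1) * ((1 + t) ^ (p + 1) - (1 - t) ^ (p + 1))
      < t / 2 * ((1 + t) ^ p + (1 - t) ^ p) + 3 * t := by
  have htabs : |t| < 1 := by rw [abs_of_pos ht0]; linarith
  have ht2 : t ^ 2 ≤ 9 / 16 := by nlinarith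
  set T : ℕ → ℝ := fun k ↦
    -Ring.choose p (2 * k + 4) * t ^ (2 * k + 5) * ((2 * k + 1) / (2 * k + 5)) with hTdef
  have hsum := ((hasSum_odd_binomial (p + 1) htabs).mul_left (2 / (p + 1))).sub
    ((hasSum_even_binomial p htabs).mul_left (t / 2))
  rw [← hasSum_nat_add_iff' 2] at hsum
  have hterm : ∀ k : ℕ, 2 / (p + 1) *
      (2 * Ring.choose (p + 1) (2 * k + 1) * t ^ (2 * k + 1)) -
      t / 2 * (2 * Ring.choose p (2 * k) * t ^ (2 * k)) =
      Ring.choose p (2 * k) * t ^ (2 * k + 1) * (4 / (2 * k + 1) - 1) := fun k ↦ by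
    have h := succ_mul_choose_add_one_succ p (2 * k)
    push_cast at h
    have hc : Ring.choose (p + 1) (2 * k + 1) = (p + 1) * Ring.choose p (2 * k) / (2 * k + 1) := by
      field_simp
      linear_combination h
    rw [hc]
    field_simp
    ring
  simp only [hterm] at hsum
  have hT : HasSum T _ := hsum.congr_fun fun k ↦ by
    simp only [hTdef]
    rw [show 2 * (k + 2) = 2 * k + 4 by ring]
    push_cast
    field_simp
    ring
  have hratio : ∀ k, T (k + 1) ≤ 45 / 56 * T k := fun k ↦ by
    have hk : (0 : ℝ) ≤ k := k.cast_nonneg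
    have hTk : 0 ≤ T k := by
      have := neg_nonneg.2 (choose_two_mul_add_four_nonpos hp0 hp1 k)
      simp only [hTdef]
      positivity
    have hstep : T (k + 1) = (2 * k + 4 - p) * (2 * k + 5 - p) * (2 * k + 3) /
        ((2 * k + 6) * (2 * k + 7) * (2 * k + 1)) * t ^ 2 * T k := by
      simp only [hTdef]
      rw [show 2 * (k + 1) + 4 = (2 * k + 4) + 2 by ring, choose_add_two]
      push_cast
      field_simp
      ring
    have hcoef : (2 * k + 4 - p) * (2 * k + 5 - p) * (2 * k + 3) /
        ((2 * k + 6) * (2 * k + 7) * (2 * k + 1)) ≤ 10 / 7 := by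
      rw [div_le_div_iff₀ (by positivity) (by norm_num)]
      have : (2 * k + 4 - p) * (2 * k + 5 - p) ≤ (2 * k + 4) * (2 * k + 5) := by nlinarith
      calc (2 * k + 4 - p) * (2 * k + 5 - p) * (2 * k + 3) * 7
          ≤ (2 * k + 4) * (2 * k + 5) * (2 * k + 3) * 7 := by gcongr
        _ ≤ 10 * ((2 * k + 6) * (2 * k + 7) * (2 * k + 1)) := by
          nlinarith [mul_nonneg hk hk, mul_nonneg hk (mul_nonneg hk hk)]
    rw [hstep]
    refine mul_le_mul_of_nonneg_right ?_ hTk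
    calc _ ≤ 10 / 7 * (9 / 16 : ℝ) := by gcongr
      _ = 45 / 56 := by norm_num
  have hle := hasSum_le_of_ratio_le hT (by norm_num) (by norm_num) hratio
  have hc₂ : Ring.choose p 2 = -(p * (1 - p) / 2) := by
    rw [choose_add_two p 0, Ring.choose_zero_right]
    norm_num
    ring
  have hT0 : T 0 = p * (1 - p) * ((2 - p) * (3 - p)) * t ^ 3 * t ^ 2 / 120 := by
    simp only [hTdef]
    rw [show 2 * 0 + 4 = 2 + 2 from rfl, choose_add_two, hc₂]
    norm_num
    ring
  rw [hT0] at hle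
  simp only [Finset.sum_range_succ, Finset.sum_range_zero, mul_zero, mul_one, hc₂,
    Ring.choose_zero_right] at hle
  norm_num at hle
  have hpos : 0 < p * (1 - p) * t ^ 3 := by
    have := sub_pos.2 hp1
    positivity
  have hsmall : (2 - p) * (3 - p) * t ^ 2 ≤ 6 * (9 / 16) := by
    have : (2 - p) * (3 - p) ≤ 6 := by nlinarith
    gcongr
  nlinarith [mul_le_mul_of_nonneg_left hsmall hpos.le]

/-- Estimate (107), Lemma 3.6: f(i+1,j−1) + f(i+1,j) − d(i+1,j) < 0 for 0 < λ < 2/3. -/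
theorem stmt_4 (lam α : ℝ) (hlam0 : 0 < lam) (hlam1 : lam < 2 / 3) (hα : α = 1 - lam)
    (i j : ℕ) (hj : j ≤ i) :
    ((2 / (2 - lam)) * (((i : ℝ) + 2 + α - j) ^ (2 - lam) - ((i : ℝ) + 1 + α - j) ^ (2 - lam))
        - (1 / 2) * (((i : ℝ) + 2 + α - j) ^ (1 - lam) + 3 * ((i : ℝ) + 1 + α - j) ^ (1 - lam)))
      + ((2 / (2 - lam)) * (((i : ℝ) + 1 + α - j) ^ (2 - lam) - ((i : ℝ) + α - j) ^ (2 - lam))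
        - (1 / 2) * (((i : ℝ) + 1 + α - j) ^ (1 - lam) + 3 * ((i : ℝ) + α - j) ^ (1 - lam)))
      - (((i : ℝ) + 1 + α - j) ^ (1 - lam) - ((i : ℝ) + α - j) ^ (1 - lam)) < 0 := by
  subst hα
  set p := 1 - lam with hp
  have hp0 : 0 < p := by linarith
  have hp1 : p < 1 := by linarith
  have hij : (j : ℝ) ≤ i := by exact_mod_cast hj
  set y : ℝ := (i : ℝ) + 1 + p - j with hy
  have hy43 : 4 / 3 ≤ y := by linarith
  have hy0 : 0 < y := by linarith
  have ht1 : 1 / y ≤ 3 / 4 := by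
    rw [div_le_div_iff₀ hy0 (by norm_num)]
    linarith
  have hscale (a : ℝ) : (y + 1) ^ a = y ^ a * (1 + 1 / y) ^ a ∧
      (y - 1) ^ a = y ^ a * (1 - 1 / y) ^ a := by
    rw [← Real.mul_rpow hy0.le (by positivity), ← Real.mul_rpow hy0.le (by linarith)]
    constructor <;> congr 1 <;> field_simp
  have hquad := mul_lt_mul_of_pos_left (rpow_quadrature_lt hp0 hp1 (one_div_pos.2 hy0) ht1)
    (Real.rpow_pos_of_pos hy0 (p + 1))
  have hyp : y ^ (p + 1) = y ^ p * y := by rw [Real.rpow_add_one hy0.ne']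
  have hcancel : y * (1 / y) = 1 := mul_one_div_cancel hy0.ne'
  rw [show (i : ℝ) + 2 + p - j = y + 1 by rw [hy]; ring,
    show (i : ℝ) + p - j = y - 1 by rw [hy]; ring, show 2 - lam = p + 1 by rw [hp]; ring]
  have hrhs : y ^ (p + 1) * (1 / y / 2 * ((1 + 1 / y) ^ p + (1 - 1 / y) ^ p) + 3 * (1 / y)) =
      ((y + 1) ^ p + (y - 1) ^ p) / 2 + 3 * y ^ p := by
    rw [(hscale p).1, (hscale p).2, hyp]
    linear_combination
      (y ^ p * ((1 + 1 / y) ^ p + (1 - 1 / y) ^ p) / 2 + 3 * y ^ p) * hcancel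
  have hlhs : y ^ (p + 1) * (2 / (p + 1) * ((1 + 1 / y) ^ (p + 1) - (1 - 1 / y) ^ (p + 1))) =
      2 / (p + 1) * ((y + 1) ^ (p + 1) - (y - 1) ^ (p + 1)) := by
    rw [(hscale (p + 1)).1, (hscale (p + 1)).2]
    ring
  rw [hrhs, hlhs] at hquad
  linarith
end

section
/- Let 0 < λ < 1 and α = 1 − λ. Then for all integers i ≥ 0 and 0 ≤ j ≤ i, one has 2·f(i+1,j) − d(i+1,j) > 0, i.e. (4/(2−λ))·((i+1+α−j)^(2−λ) − (i+α−j)^(2−λ)) − 2·((i+1+α−j)^(1−λ) + (i+α−j)^(1−λ)) > 0. -/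
/-- The strict tangent line inequality for the concave power function, at `t` looking left. -/
theorem rpow_lt_rpow_sub_tangent {p a t : ℝ} (hp0 : 0 < p) (hp1 : p < 1) (ha : 0 < a)
    (hat : a < t) : a ^ p < t ^ p - p * t ^ (p - 1) * (t - a) := by
  have ht : 0 < t := ha.trans hat
  have hs : a / t - 1 ≠ 0 := (sub_neg.2 ((div_lt_one ht).2 hat)).ne
  have h := rpow_one_add_lt_one_add_mul_self (s := a / t - 1)
    (by linarith [div_pos ha ht]) hs hp0 hp1
  rw [add_sub_cancel, Real.div_rpow ha.le ht.le, div_lt_iff₀ (Real.rpow_pos_of_pos ht p)] at h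
  rw [Real.rpow_sub_one ht.ne']
  refine h.trans_eq ?_
  field_simp
  ring

/-- The trapezoidal rule strictly underestimates the integral of `t ^ p` for `0 < p < 1`. -/
theorem rpow_trapezoid_lt {p a b : ℝ} (hp0 : 0 < p) (hp1 : p < 1) (ha : 0 < a) (hab : a < b) :
    (b - a) * (b ^ p + a ^ p) < 2 / (p + 1) * (b ^ (p + 1) - a ^ (p + 1)) := by
  let F : ℝ → ℝ := fun t ↦
    2 / (p + 1) * (t ^ (p + 1) - a ^ (p + 1)) - (t - a) * (t ^ p + a ^ p)
  have hF : ∀ t, 0 < t → HasDerivAt F (t ^ p - p * t ^ (p - 1) * (t - a) - a ^ p) t := by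
    intro t ht
    have h1 := (Real.hasDerivAt_rpow_const (p := p + 1) (Or.inl ht.ne')).sub_const (a ^ (p + 1))
    have h2 := (Real.hasDerivAt_rpow_const (p := p) (Or.inl ht.ne')).add_const (a ^ p)
    refine ((h1.const_mul (2 / (p + 1))).sub
      (((hasDerivAt_id t).sub_const a).mul h2)).congr_deriv ?_
    rw [add_sub_cancel_right]
    simp only [id]
    field_simp
    ring
  have hmono : StrictMonoOn F (Set.Ici a) := by
    refine strictMonoOn_of_deriv_pos (convex_Ici a)
      (fun t ht ↦ (hF t (ha.trans_le ht)).continuousAt.continuousWithinAt) fun t ht ↦ ?_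
    rw [interior_Ici] at ht
    rw [(hF t (ha.trans ht)).deriv]
    linarith [rpow_lt_rpow_sub_tangent hp0 hp1 ha ht]
  have h := hmono Set.self_mem_Ici hab.le hab
  simp only [F, sub_self, mul_zero, zero_mul] at h
  linarith

/-- Relation (98), Lemma 3.6: 2·f(i+1,j) − d(i+1,j) > 0. -/
theorem stmt_5 (lam α : ℝ) (hlam0 : 0 < lam) (hlam1 : lam < 1) (hα : α = 1 - lam)
    (i j : ℕ) (hj : j ≤ i) :
    0 < (4 / (2 - lam)) * (((i : ℝ) + 1 + α - j) ^ (2 - lam) - ((i : ℝ) + α - j) ^ (2 - lam))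
        - 2 * (((i : ℝ) + 1 + α - j) ^ (1 - lam) + ((i : ℝ) + α - j) ^ (1 - lam)) := by
  have hji : (j : ℝ) ≤ i := by exact_mod_cast hj
  have h := rpow_trapezoid_lt (p := 1 - lam) (a := (i : ℝ) + α - j) (b := (i : ℝ) + 1 + α - j)
    (by linarith) (by linarith) (by linarith) (by linarith)
  rw [show (i : ℝ) + 1 + α - j - (i + α - j) = 1 by ring,
    show 1 - lam + 1 = 2 - lam by ring, one_mul] at h
  rw [show (4 : ℝ) / (2 - lam) = 2 * (2 / (2 - lam)) by ring]
  linarith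
end

section
/- Let 0 < λ < 2/3 and α = 1 − λ. Then for all integers i ≥ 0 and 0 ≤ l ≤ i, one has d(i+1,l) − f(i+1,l) > ((2−3λ)·(1−λ)/(2·(2−λ)))·(i+1+α−l)^(−λ). -/
open Set in
/-- A rational lower bound for `w ^ s` on the unit interval, with denominators cleared. -/
theorem rational_lt_mul_rpow {s w : ℝ} (hs : 1 / 3 < s) (hs1 : s < 1) (hw : 0 < w) (hw1 : w < 1) :
    4 + s * (3 * s - 1) * (1 - w) ^ 2 - 3 * (1 + s) * (1 - w)
      < ((1 + s) * (1 - w) + 4 * w) * w ^ s := by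
  set F : ℝ → ℝ := fun t => ((1 + s) * (1 - t) + 4 * t)
    - (4 + s * (3 * s - 1) * (1 - t) ^ 2 - 3 * (1 + s) * (1 - t)) * t ^ (-s) with hF
  have hderiv : ∀ t : ℝ, 0 < t → HasDerivAt F ((3 - s)
      - ((-2 * s * (3 * s - 1) * (1 - t) + 3 * (1 + s)) * t ^ (-s)
        + (4 + s * (3 * s - 1) * (1 - t) ^ 2 - 3 * (1 + s) * (1 - t))
          * (-s * t ^ (-s - 1)))) t := by
    intro t ht
    have h1 : HasDerivAt (fun t : ℝ => 1 - t) (-1) t := by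
      simpa using (hasDerivAt_id t).const_sub 1
    have h2 : HasDerivAt (fun t : ℝ => (1 + s) * (1 - t) + 4 * t) (3 - s) t := by
      refine ((h1.const_mul (1 + s)).add ((hasDerivAt_id t).const_mul 4)).congr_deriv ?_
      ring
    have h3 : HasDerivAt
        (fun t : ℝ => 4 + s * (3 * s - 1) * (1 - t) ^ 2 - 3 * (1 + s) * (1 - t))
        (-2 * s * (3 * s - 1) * (1 - t) + 3 * (1 + s)) t := by
      refine ((((h1.pow 2).const_mul (s * (3 * s - 1))).const_add 4).sub
        (h1.const_mul (3 * (1 + s)))).congr_deriv ?_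
      push_cast
      ring
    exact h2.sub (h3.mul (Real.hasDerivAt_rpow_const (Or.inl ht.ne')))
  have hneg : ∀ t ∈ interior (Icc w 1), deriv F t < 0 := by
    intro t ht
    rw [interior_Icc] at ht
    have ht0 : 0 < t := hw.trans ht.1
    have ht1 : 0 < 1 - t := sub_pos.2 ht.2
    rw [(hderiv t ht0).deriv]
    have hp : 0 < t ^ (-s - 1) := Real.rpow_pos_of_pos ht0 _
    have hq : t ^ (-s) = t ^ (-s - 1) * t := by
      rw [← Real.rpow_add_one ht0.ne']
      ring_nf
    have hr : t ^ (-s - 1) * (t * t ^ s) = 1 := by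
      rw [← mul_assoc, ← hq, ← Real.rpow_add ht0]
      simp
    have hb : t ^ s ≤ 1 + s * (t - 1) := by
      simpa using rpow_one_add_le_one_add_mul_self (s := t - 1) (by linarith) (p := s)
        (by linarith) hs1.le
    have key : (3 - s) * (t * t ^ s)
        - (-2 * s * (3 * s - 1) * (1 - t) + 3 * (1 + s)) * t
        + s * (4 + s * (3 * s - 1) * (1 - t) ^ 2 - 3 * (1 + s) * (1 - t)) < 0 := by
      have hb' : (3 - s) * (t * t ^ s) ≤ (3 - s) * (t * (1 + s * (t - 1))) := by
        gcongr
        linarith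
      have hc : 0 < (1 - t) * (s * (1 - s) * ((3 * s - 1) + (5 - 3 * s) * t)) := by
        have h1s : 0 < 1 - s := by linarith
        have h3s : 0 < 3 * s - 1 := by linarith
        have h5s : 0 < 5 - 3 * s := by linarith
        positivity
      linarith
    have := mul_neg_of_pos_of_neg hp key
    rw [hq]
    linear_combination this - (3 - s) * hr
  have hanti : StrictAntiOn F (Icc w 1) :=
    strictAntiOn_of_deriv_neg (convex_Icc w 1)
      (fun t ht => (hderiv t (hw.trans_le ht.1)).continuousAt.continuousWithinAt) hneg
  have hlt : F 1 < F w := hanti ⟨le_rfl, hw1.le⟩ ⟨hw1.le, le_rfl⟩ hw1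
  have hpos : 0 < w ^ s := Real.rpow_pos_of_pos hw s
  have hinv : w ^ (-s) * w ^ s = 1 := by
    rw [← Real.rpow_add hw]
    simp
  have h1 : F 1 = 0 := by simp [hF]
  rw [h1] at hlt
  have := mul_pos hlt hpos
  simp only [hF] at this
  linear_combination this
    - (4 + s * (3 * s - 1) * (1 - w) ^ 2 - 3 * (1 + s) * (1 - w)) * hinv

theorem rpow_weight_lower_bound {s x : ℝ} (hs : 1 / 3 < s) (hs1 : s < 1) (hx : 0 < x) :
    (3 * s - 1) * s / (2 * (1 + s)) * (x + 1) ^ (s - 1)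
      < ((x + 1) ^ s - x ^ s) - (2 / (1 + s) * ((x + 1) ^ (1 + s) - x ^ (1 + s))
        - 1 / 2 * ((x + 1) ^ s + 3 * x ^ s)) := by
  have ha : 0 < x + 1 := by linarith
  have hs' : 0 < 1 + s := by linarith
  have hA : 0 < (x + 1) ^ s := Real.rpow_pos_of_pos ha s
  have hlt := rational_lt_mul_rpow hs hs1 (div_pos hx ha) ((div_lt_one ha).2 (by linarith))
  rw [Real.div_rpow hx.le ha.le] at hlt
  rw [Real.rpow_sub_one ha.ne', Real.rpow_one_add' ha.le hs'.ne', Real.rpow_one_add' hx.le hs'.ne']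
  have hw : 1 - x / (x + 1) = 1 / (x + 1) := by
    field_simp
    ring
  rw [hw] at hlt
  rw [← sub_pos] at hlt ⊢
  refine (mul_pos hlt (div_pos (mul_pos hA ha) (mul_pos two_pos hs'))).trans_eq ?_
  field_simp
  ring

/-- Estimate (109), Lemma 3.6: lower bound on d(i+1,l) − f(i+1,l). -/
theorem stmt_6 (lam α : ℝ) (hlam0 : 0 < lam) (hlam1 : lam < 2 / 3) (hα : α = 1 - lam)
    (i l : ℕ) (hl : l ≤ i) :
    ((2 - 3 * lam) * (1 - lam) / (2 * (2 - lam))) * ((i : ℝ) + 1 + α - l) ^ (-lam)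
      < (((i : ℝ) + 1 + α - l) ^ (1 - lam) - ((i : ℝ) + α - l) ^ (1 - lam))
        - ((2 / (2 - lam)) * (((i : ℝ) + 1 + α - l) ^ (2 - lam) - ((i : ℝ) + α - l) ^ (2 - lam))
          - (1 / 2) * (((i : ℝ) + 1 + α - l) ^ (1 - lam) + 3 * ((i : ℝ) + α - l) ^ (1 - lam))) := by
  have hil : (l : ℝ) ≤ i := by exact_mod_cast hl
  have h := rpow_weight_lower_bound (s := 1 - lam) (x := (i : ℝ) + α - l)
    (by linarith) (by linarith) (by linarith)
  rwa [show (i : ℝ) + α - l + 1 = i + 1 + α - l by ring,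
    show 3 * (1 - lam) - 1 = 2 - 3 * lam by ring, show 1 + (1 - lam) = 2 - lam by ring,
    show 1 - lam - 1 = -lam by ring] at h
end

section
/- Let 0 < λ < 2/3 and α = 1 − λ. Then for all integers i ≥ 0 and 0 ≤ j ≤ i, one has f(i+1,j) > ((2−3λ)·(1−λ)/(2·(2−λ)))·(i+1+α−j)^(−λ). -/
/-- Strict Bernoulli inequality, in the homogeneous form `(x - 1) ^ p < x ^ p * (1 - p / x)`. -/
theorem Real.sub_one_rpow_lt {x p : ℝ} (hx : 1 < x) (hp0 : 0 < p) (hp1 : p < 1) :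
    (x - 1) ^ p < x ^ p * (1 - p / x) := by
  have hx0 : 0 < x := by linarith
  have hinv : x⁻¹ < 1 := inv_lt_one_of_one_lt₀ hx
  have hb := rpow_one_add_lt_one_add_mul_self (s := -x⁻¹) (by linarith)
    (neg_ne_zero.2 (inv_ne_zero hx0.ne')) hp0 hp1
  calc (x - 1) ^ p = x ^ p * (1 + -x⁻¹) ^ p := by
        rw [← Real.mul_rpow hx0.le (by linarith)]
        congr 1
        field_simp
        ring
    _ < x ^ p * (1 + p * -x⁻¹) := mul_lt_mul_of_pos_left hb (Real.rpow_pos_of_pos hx0 p)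
    _ = x ^ p * (1 - p / x) := by ring

/-- Estimate (110), Lemma 3.6: lower bound on f(i+1,j). -/
theorem stmt_7 (lam α : ℝ) (hlam0 : 0 < lam) (hlam1 : lam < 2 / 3) (hα : α = 1 - lam)
    (i j : ℕ) (hj : j ≤ i) :
    ((2 - 3 * lam) * (1 - lam) / (2 * (2 - lam))) * ((i : ℝ) + 1 + α - j) ^ (-lam)
      < (2 / (2 - lam)) * (((i : ℝ) + 1 + α - j) ^ (2 - lam) - ((i : ℝ) + α - j) ^ (2 - lam))
        - (1 / 2) * (((i : ℝ) + 1 + α - j) ^ (1 - lam) + 3 * ((i : ℝ) + α - j) ^ (1 - lam)) := by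
  have hji : (j : ℝ) ≤ i := by exact_mod_cast hj
  obtain ⟨x, hx⟩ : ∃ x : ℝ, x = (i : ℝ) + 1 + α - j := ⟨_, rfl⟩
  have hx1 : 1 < x := by linarith
  have hx0 : 0 < x := by linarith
  rw [← hx, show (i : ℝ) + α - j = x - 1 by linarith,
    show (2 : ℝ) - lam = (1 - lam) + 1 by ring, Real.rpow_add_one hx0.ne',
    Real.rpow_add_one (by linarith : x - 1 ≠ 0),
    show -lam = (1 - lam) - 1 by ring, Real.rpow_sub_one hx0.ne']
  have key := Real.sub_one_rpow_lt hx1 (by linarith : 0 < 1 - lam) (by linarith)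
  generalize x ^ (1 - lam) = a at key ⊢
  generalize (x - 1) ^ (1 - lam) = b at key ⊢
  have hc : 0 < (4 * x + 2 - 3 * lam) / (2 * (2 - lam)) := div_pos (by linarith) (by linarith)
  have hl : (2 : ℝ) - lam ≠ 0 := by linarith
  rw [← sub_pos]
  refine (mul_pos hc (sub_pos.2 key)).trans_eq ?_
  rw [show (1 : ℝ) - lam + 1 = 2 - lam by ring]
  field_simp
  ring
end

section
/- Let 0 < λ < 2/3 and α = 1 − λ. Then for every integer i ≥ 0, f(i+1,i) + α^(1−λ) > ((2−3λ)·(1−λ)/(2·(2−λ)))·α^(−λ). -/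
/-- A consequence of Bernoulli's inequality for `(1 + 1 / a) ^ (1 + a)`. -/
lemma three_mul_rpow_one_add_le {a : ℝ} (ha : 0 < a) (ha1 : a ≤ 1) :
    3 * a ^ (1 + a) ≤ (1 + a) ^ (1 + a) := by
  have hB := one_add_mul_self_le_rpow_one_add (s := 1 / a) (p := 1 + a)
    (by have := one_div_pos.mpr ha; linarith) (by linarith)
  have h3 : 3 ≤ 1 + (1 + a) * (1 / a) := by
    have h1 : 1 ≤ 1 / a := by rwa [le_div_iff₀ ha, one_mul]
    have h2 : (1 + a) * (1 / a) = 1 / a + 1 := by field_simp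
    linarith
  have hq : 1 + 1 / a = (1 + a) / a := by field_simp; ring
  rw [hq, Real.div_rpow (by linarith) ha.le] at hB
  exact (le_div_iff₀ (Real.rpow_pos_of_pos ha _)).mp (h3.trans hB)

/-- Estimate (112), Lemma 3.6: lower bound on the leading weight f(i+1,i) + α^{1−λ}. -/
theorem stmt_8 (lam α : ℝ) (hlam0 : 0 < lam) (hlam1 : lam < 2 / 3) (hα : α = 1 - lam)
    (i : ℕ) :
    ((2 - 3 * lam) * (1 - lam) / (2 * (2 - lam))) * α ^ (-lam)
      < ((2 / (2 - lam)) * (((i : ℝ) + 1 + α - i) ^ (2 - lam) - ((i : ℝ) + α - i) ^ (2 - lam))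
          - (1 / 2) * (((i : ℝ) + 1 + α - i) ^ (1 - lam) + 3 * ((i : ℝ) + α - i) ^ (1 - lam)))
        + α ^ (1 - lam) := by
  obtain rfl : lam = 1 - α := by linarith
  have hpos : 0 < α := by linarith
  have hpos1 : 0 < 1 + α := by linarith
  have key := three_mul_rpow_one_add_le hpos (by linarith)
  rw [show (i : ℝ) + 1 + α - i = 1 + α by ring, show (i : ℝ) + α - i = α by ring,
    show 2 - (1 - α) = 1 + α by ring, show 1 - (1 - α) = α by ring,
    show -(1 - α) = α - 1 by ring, Real.rpow_sub_one hpos.ne']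
  rw [Real.rpow_one_add' hpos.le hpos1.ne', Real.rpow_one_add' hpos1.le hpos1.ne'] at *
  have hA : 0 < α * α ^ α := mul_pos hpos (Real.rpow_pos_of_pos hpos α)
  generalize α ^ α = A at *
  generalize (1 + α) ^ α = B at *
  rw [← sub_pos]
  have hdiff : 2 / (1 + α) * ((1 + α) * B - α * A) - 1 / 2 * (B + 3 * A) + A
      - (2 - 3 * (1 - α)) * α / (2 * (1 + α)) * (A / α)
      = (3 * ((1 + α) * B) - 8 * (α * A)) / (2 * (1 + α)) := by
    field_simp
    ring
  rw [hdiff]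
  exact div_pos (by linarith) (by linarith)
end
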